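/- arXiv:2001.04132 — 2 statements merged into one kernel-verified Lean document; each statement's English description precedes it below -/
import Mathlib

section
/- Let H be an r-uniform r-partite k-wise t-intersecting hypergraph with 1 ≤ t ≤ r. If either k ≥ 3, or k = 2 and r ≤ 3t − 1, then τ(H) ≤ ⌊(r−t)/k⌋ + 1. -/
/-- `E` is the edge set of an `r`-uniform `r`-partite hypergraph on vertex type `V`
with parts given by the fibres of `part`: each edge contains exactly one vertex
from each of the `r` parts. -/
def IsRPartite {V : Type} (r : ℕ) (part : V → Fin r) (E : Finset (Finset V)) : Prop :=
  ∀ e ∈ E, ∀ j : Fin r, (e.filter (fun v => part v = j)).card = 1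

/-- The hypergraph with edge set `E` is `t`-intersecting. -/
def IntersectingGe {V : Type} (t : ℕ) (E : Finset (Finset V)) : Prop :=
  ∀ e ∈ E, ∀ f ∈ E, t ≤ ((↑e ∩ ↑f : Set V)).ncard

/-- `C` is a vertex cover of the hypergraph with edge set `E`. -/
def IsCover {V : Type} (E : Finset (Finset V)) (C : Finset V) : Prop :=
  ∀ e ∈ E, ∃ v ∈ e, v ∈ C

/-- The cover number: the minimum size of a vertex cover. -/
noncomputable def coverNumber {V : Type} (E : Finset (Finset V)) : ℕ :=
  sInf {n | ∃ C : Finset V, IsCover E C ∧ C.card = n}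

/-- The hypergraph with edge set `E` is `k`-wise `t`-intersecting: any `k` edges
(repetitions allowed) have at least `t` common vertices. -/
def KWiseIntersecting {V : Type} (k t : ℕ) (E : Finset (Finset V)) : Prop :=
  ∀ f : Fin k → Finset V, (∀ i, f i ∈ E) → t ≤ (⋂ i, (↑(f i) : Set V)).ncard

theorem coverNumber_le_card {V : Type} {E : Finset (Finset V)} {C : Finset V}
    (hC : IsCover E C) : coverNumber E ≤ C.card :=
  Nat.sInf_le ⟨C, hC, rfl⟩

theorem IsRPartite.eq_of_part_eq {V : Type} {r : ℕ} {part : V → Fin r} {E : Finset (Finset V)}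
    (hP : IsRPartite r part E) {e : Finset V} (he : e ∈ E) {v w : V} (hv : v ∈ e) (hw : w ∈ e)
    (h : part v = part w) : v = w :=
  Finset.card_le_one.1 (hP e he (part w)).le v (by simp [hv, h]) w (by simp [hw])

theorem card_le_of_part_injective {V : Type} {r : ℕ} {part : V → Fin r} {U : Finset V}
    (h : ∀ v ∈ U, ∀ w ∈ U, part v = part w → v = w) : U.card ≤ r := by
  simpa using Finset.card_le_card_of_injOn (t := Finset.univ) part (by simp)
    (fun v hv w hw hvw => h v hv w hw hvw)

/-- If every edge meets `A` in at least `s ≥ 1` vertices, any `|A| - s + 1` vertices of `A`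
form a cover. -/
theorem coverNumber_add_le {V : Type} [DecidableEq V] {E : Finset (Finset V)} {A : Finset V} {s : ℕ}
    (hs : 1 ≤ s) (hsA : s ≤ A.card) (hA : ∀ g ∈ E, s ≤ (A ∩ g).card) :
    coverNumber E + s ≤ A.card + 1 := by
  obtain ⟨C, hCA, hC⟩ := Finset.exists_subset_card_eq (s := A) (n := A.card + 1 - s) (by omega)
  have hcov : IsCover E C := by
    intro g hg
    by_contra! hdis
    have hsub : A ∩ g ⊆ A \ C := by
      intro v hv
      simp only [Finset.mem_inter, Finset.mem_sdiff] at hv ⊢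
      exact ⟨hv.1, hdis v hv.2⟩
    have h1 := Finset.card_le_card hsub
    rw [Finset.card_sdiff_of_subset hCA] at h1
    have h2 := hA g hg
    omega
  have := coverNumber_le_card hcov
  omega

theorem coverNumber_le_of_two {V : Type} [DecidableEq V] {r s : ℕ} {part : V → Fin r}
    {E : Finset (Finset V)} (hP : IsRPartite r part E) {e f : Finset V} (he : e ∈ E) (hf : f ∈ E)
    (hcard : (e ∩ f).card = s) (hr : r < 3 * s)
    (hge : ∀ g ∈ E, s ≤ (e ∩ g).card) (hgf : ∀ g ∈ E, s ≤ (f ∩ g).card) :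
    coverNumber E ≤ (r - s) / 2 + 1 := by
  obtain ⟨C, hCT, hC⟩ :=
    Finset.exists_subset_card_eq (s := e ∩ f) (n := (r - s) / 2 + 1) (by omega)
  rw [← hC]
  refine coverNumber_le_card fun g hg => ?_
  by_contra! hdis
  have hCe : ∀ v ∈ C, v ∈ e ∧ v ∈ f := fun v hv => Finset.mem_inter.1 (hCT hv)
  have hdisj : Disjoint (e ∩ g ∪ f ∩ g) C := by
    rw [Finset.disjoint_left]
    intro v hv
    apply hdis
    simp only [Finset.mem_union, Finset.mem_inter] at hv
    tauto
  have hU : (e ∩ g ∪ f ∩ g ∪ C).card ≤ r := by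
    apply card_le_of_part_injective (part := part)
    intro v hv w hw hvw
    simp only [Finset.mem_union, Finset.mem_inter] at hv hw
    have hv' := hCe v
    have hw' := hCe w
    have h : (v ∈ e ∧ w ∈ e) ∨ (v ∈ f ∧ w ∈ f) ∨ (v ∈ g ∧ w ∈ g) := by tauto
    rcases h with h | h | h
    · exact hP.eq_of_part_eq he h.1 h.2 hvw
    · exact hP.eq_of_part_eq hf h.1 h.2 hvw
    · exact hP.eq_of_part_eq hg h.1 h.2 hvw
  rw [Finset.card_union_of_disjoint hdisj] at hU
  have hI : ((e ∩ g) ∩ (f ∩ g)).card ≤ ((e ∩ f) \ C).card := by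
    refine Finset.card_le_card fun v hv => ?_
    simp only [Finset.mem_inter, Finset.mem_sdiff] at hv ⊢
    exact ⟨⟨hv.1.1, hv.2.1⟩, hdis v hv.1.2⟩
  rw [Finset.card_sdiff_of_subset hCT] at hI
  have h1 := Finset.card_union_add_card_inter (e ∩ g) (f ∩ g)
  have h2 := hge g hg
  have h3 := hgf g hg
  omega

/-- For `k ≥ 3`, the vertices lying in at least `k - 1` of the edges `f i` form a partial
transversal of the parts, so some `k - 1` of the edges have a small common intersection. -/
theorem exists_card_inter_others_le {V : Type} [Fintype V] [DecidableEq V] {r k : ℕ}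
    (hk : 3 ≤ k)
    {part : V → Fin r} {E : Finset (Finset V)} (hP : IsRPartite r part E)
    {f : Fin k → Finset V} (hf : ∀ i, f i ∈ E) :
    ∃ i, (Finset.univ.filter fun v => ∀ j ≠ i, v ∈ f j).card ≤
      (r - (Finset.univ.filter fun v => ∀ j, v ∈ f j).card) / k +
        (Finset.univ.filter fun v => ∀ j, v ∈ f j).card := by
  set T := Finset.univ.filter fun v => ∀ j, v ∈ f j with hT
  set A : Fin k → Finset V := fun i => Finset.univ.filter fun v => ∀ j ≠ i, v ∈ f j with hA
  have hTA : ∀ i, T ⊆ A i := by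
    intro i v hv
    simp only [hT, hA, Finset.mem_filter, Finset.mem_univ, true_and] at hv ⊢
    exact fun j _ => hv j
  have hdisj : ∀ i ∈ Finset.univ, ∀ j ∈ Finset.univ, i ≠ j → Disjoint (A i \ T) (A j \ T) := by
    intro i _ j _ hij
    rw [Finset.disjoint_left]
    intro v hv hw
    simp only [hT, hA, Finset.mem_sdiff, Finset.mem_filter, Finset.mem_univ, true_and] at hv hw
    refine hv.2 fun l => ?_
    by_cases hl : l = i
    · exact hw.1 l (hl ▸ hij)
    · exact hv.1 l hl
  have hU : (T ∪ Finset.univ.biUnion fun i => A i \ T).card ≤ r := by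
    apply card_le_of_part_injective (part := part)
    have hmem : ∀ v ∈ T ∪ Finset.univ.biUnion (fun i => A i \ T), ∃ i, ∀ j ≠ i, v ∈ f j := by
      intro v hv
      rw [Finset.mem_union, Finset.mem_biUnion] at hv
      rcases hv with hv | ⟨i, -, hv⟩
      · exact ⟨⟨0, by omega⟩, fun j _ => (Finset.mem_filter.1 hv).2 j⟩
      · exact ⟨i, (Finset.mem_filter.1 (Finset.mem_sdiff.1 hv).1).2⟩
    intro v hv w hw hvw
    obtain ⟨i, hi⟩ := hmem v hv
    obtain ⟨j, hj⟩ := hmem w hw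
    obtain ⟨l, hl⟩ : ∃ l, l ∉ ({i, j} : Finset (Fin k)) := by
      by_contra! h
      have h1 := Finset.card_le_card fun l (_ : l ∈ Finset.univ) => h l
      have h2 := Finset.card_le_two (a := i) (b := j)
      rw [Finset.card_fin] at h1
      omega
    simp only [Finset.mem_insert, Finset.mem_singleton, not_or] at hl
    exact hP.eq_of_part_eq (hf l) (hi l hl.1) (hj l hl.2) hvw
  have hTd : Disjoint T (Finset.univ.biUnion fun i => A i \ T) := by
    rw [Finset.disjoint_biUnion_right]
    exact fun i _ => Finset.disjoint_sdiff
  rw [Finset.card_union_of_disjoint hTd, Finset.card_biUnion hdisj] at hU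
  by_contra! hlt
  have hlow : ∀ i ∈ Finset.univ, (r - T.card) / k + 1 ≤ (A i \ T).card := by
    intro i _
    have h1 : (r - T.card) / k + T.card < (A i).card := hlt i
    rw [Finset.card_sdiff_of_subset (hTA i)]
    omega
  have hsum := Finset.card_nsmul_le_sum _ _ _ hlow
  rw [Finset.card_fin, smul_eq_mul] at hsum
  have := Nat.lt_mul_div_succ (r - T.card) (show 0 < k by omega)
  omega

/-- **Theorem 1.6** (upper bound): if `H` is an `r`-uniform `r`-partite `k`-wise
`t`-intersecting hypergraph and either `k ≥ 3`, or `k = 2` and `r ≤ 3t - 1`, then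
`τ(H) ≤ ⌊(r - t)/k⌋ + 1`. -/
theorem kwise_cover_le {V : Type} [Fintype V] (r t k : ℕ)
    (ht : 1 ≤ t) (htr : t ≤ r)
    (hk : 3 ≤ k ∨ (k = 2 ∧ r ≤ 3 * t - 1))
    (part : V → Fin r) (E : Finset (Finset V))
    (hP : IsRPartite r part E) (hI : KWiseIntersecting k t E) :
    coverNumber E ≤ (r - t) / k + 1 := by
  classical
  rcases E.eq_empty_or_nonempty with rfl | ⟨e₀, he₀⟩
  · exact (coverNumber_le_card (C := ∅) (by simp [IsCover])).trans (by simp)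
  have hcoe : ∀ f : Fin k → Finset V, (⋂ i, (↑(f i) : Set V)).ncard =
      (Finset.univ.filter fun v => ∀ j, v ∈ f j).card := by
    intro f
    rw [← Set.ncard_coe_finset]
    congr 1
    ext v
    simp
  obtain ⟨f, hf, hmin⟩ := Set.exists_min_image {f : Fin k → Finset V | ∀ i, f i ∈ E}
    (fun f => (Finset.univ.filter fun v => ∀ j, v ∈ f j).card) (Set.toFinite _)
    ⟨fun _ => e₀, fun _ => he₀⟩
  have hts := hI f hf
  rw [hcoe] at hts
  set s := (Finset.univ.filter fun v => ∀ j, v ∈ f j).card with hs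
  have hmeet : ∀ i, ∀ g ∈ E, s ≤ ((Finset.univ.filter fun v => ∀ j ≠ i, v ∈ f j) ∩ g).card := by
    intro i g hg
    refine (hmin (Function.update f i g) fun j => ?_).trans (Finset.card_le_card fun v hv => ?_)
    · by_cases hj : j = i
      · subst hj; simpa using hg
      · simpa [hj] using hf j
    · simp only [Finset.mem_filter, Finset.mem_univ, true_and, Finset.mem_inter] at hv ⊢
      exact ⟨fun j hj => by simpa [hj] using hv j, by simpa using hv i⟩
  have hdiv : (r - s) / k ≤ (r - t) / k := Nat.div_le_div_right (by omega)
  rcases hk with hk | ⟨rfl, hr⟩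
  · obtain ⟨i, hi⟩ := exists_card_inter_others_le hk hP hf
    rw [← hs] at hi
    have := coverNumber_add_le (by omega)
      ((hmeet i e₀ he₀).trans (Finset.card_le_card Finset.inter_subset_left)) (hmeet i)
    omega
  · have h0 := hmeet 1
    have h1 := hmeet 0
    simp only [Fin.forall_fin_two, ne_eq, not_true_eq_false, false_imp_iff, true_and, and_true,
      zero_ne_one, one_ne_zero, not_false_eq_true, true_imp_iff, Finset.filter_univ_mem] at h0 h1
    have hcard : (f 0 ∩ f 1).card = s := by
      rw [hs]
      congr 1
      ext v
      simp [Fin.forall_fin_two]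
    have := coverNumber_le_of_two hP (hf 0) (hf 1) hcard (by omega) h0 h1
    omega
end

section
/- For all integers r and t with t ≥ 1 and 3t ≤ r ≤ 5t − 2, every (r,t)-graph H satisfies τ(H) ≤ ⌈(5r − 10t + 2)/4⌉ + ⌈(6t − r − 1)/8⌉. -/
/-- The set of parts on which two transversals agree. -/
noncomputable def agreeSet {V : Type} {r : ℕ} (f g : Fin r → V) : Finset (Fin r) := by
  classical exact Finset.univ.filter fun j => f j = g j

theorem mem_agreeSet {V : Type} {r : ℕ} {f g : Fin r → V} {j : Fin r} :
    j ∈ agreeSet f g ↔ f j = g j := by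
  simp [agreeSet]

theorem card_eq_sum_ite {r : ℕ} (S : Finset (Fin r)) :
    S.card = ∑ j, if j ∈ S then 1 else 0 := by
  simp

/-- No choice of at most `c` vertices, listed part by part, meets every member of `F`. -/
def Evades {V : Type} {r : ℕ} (F : Set (Fin r → V)) (c : ℕ) : Prop :=
  ∀ W : Fin r → Finset V, ∑ j, (W j).card ≤ c → ∃ g ∈ F, ∀ j, g j ∉ W j

theorem Evades.exists_agreeSet_subset {V : Type} {r c : ℕ} {F : Set (Fin r → V)}
    (hF : Evades F c) (e : Fin r → V) (M : Finset (Fin r)) (hM : r ≤ c + M.card) :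
    ∃ g ∈ F, agreeSet g e ⊆ M := by
  classical
  obtain ⟨g, hg, h⟩ := hF (fun j => if j ∈ M then ∅ else {e j}) (by
    have h1 : ∑ j, (if j ∈ M then (∅ : Finset V) else {e j}).card + M.card
        = ∑ _j : Fin r, 1 := by
      rw [card_eq_sum_ite M, ← Finset.sum_add_distrib]
      refine Finset.sum_congr rfl fun j _ => ?_
      split_ifs <;> simp
    simp only [Finset.sum_const, Finset.card_univ, Fintype.card_fin, smul_eq_mul, mul_one] at h1
    omega)
  refine ⟨g, hg, fun j hj => ?_⟩
  by_contra hjM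
  have := h j
  simp only [if_neg hjM, Finset.mem_singleton] at this
  exact this (mem_agreeSet.1 hj)

/-- Covers built from two transversals. -/
theorem Evades.lt_of_pair {V : Type} {r t c : ℕ} {F : Set (Fin r → V)}
    (hF : Evades F c) (hI : ∀ e ∈ F, ∀ f ∈ F, t ≤ (agreeSet e f).card)
    {e f : Fin r → V} (he : e ∈ F) (hf : f ∈ F) {y z : ℕ}
    (hy : y ≤ (agreeSet e f).card) (hz : z + (agreeSet e f).card ≤ r)
    (hyz : r + (agreeSet e f).card < 2 * t + 2 * y + z) : c < y + 2 * z := by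
  classical
  by_contra! hc
  obtain ⟨Y, hYK, rfl⟩ := Finset.exists_subset_card_eq hy
  obtain ⟨Z, hZK, rfl⟩ : ∃ Z ⊆ (agreeSet e f)ᶜ, Z.card = z := by
    apply Finset.exists_subset_card_eq
    rw [Finset.card_compl, Fintype.card_fin]
    omega
  obtain ⟨g, hg, h⟩ := hF
    (fun j => if j ∈ Y then {e j} else if j ∈ Z then {e j, f j} else ∅) (by
      refine le_trans ?_ hc
      rw [card_eq_sum_ite Y, card_eq_sum_ite Z, Finset.mul_sum, ← Finset.sum_add_distrib]
      refine Finset.sum_le_sum fun j _ => ?_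
      have := Finset.card_le_two (a := e j) (b := f j)
      split_ifs <;> simp <;> omega)
  have h1 := hI g hg e he
  have h2 := hI g hg f hf
  have key : (agreeSet g e).card + (agreeSet g f).card + 2 * Y.card + Z.card
      ≤ (∑ _j : Fin r, 1) + (agreeSet e f).card := by
    rw [card_eq_sum_ite Y, card_eq_sum_ite Z, card_eq_sum_ite (agreeSet g e),
      card_eq_sum_ite (agreeSet g f), card_eq_sum_ite (agreeSet e f), Finset.mul_sum]
    simp only [← Finset.sum_add_distrib]
    refine Finset.sum_le_sum fun j _ => ?_
    have hj := h j
    have hY := @hYK j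
    have hZ := @hZK j
    simp only [Finset.mem_compl, mem_agreeSet] at hY hZ ⊢
    by_cases a : j ∈ Y <;> by_cases b : j ∈ Z <;> simp_all <;> split_ifs <;> simp_all
  simp only [Finset.sum_const, Finset.card_univ, Fintype.card_fin, smul_eq_mul, mul_one] at key
  omega

/-- Covers built from three transversals: `A` is where all three agree, `B` where exactly two
of them agree. -/
theorem Evades.lt_of_triple {V : Type} {r t c : ℕ} {F : Set (Fin r → V)}
    (hF : Evades F c) (hI : ∀ e ∈ F, ∀ f ∈ F, t ≤ (agreeSet e f).card)
    {e f h : Fin r → V} (he : e ∈ F) (hf : f ∈ F) (hh : h ∈ F) {A B : Finset (Fin r)}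
    (hA : ∀ j, j ∈ A ↔ f j = e j ∧ h j = e j)
    (hB : ∀ j, j ∈ B ↔ (f j = e j ∨ h j = e j ∨ f j = h j) ∧ j ∉ A) {y z : ℕ}
    (hy : y ≤ B.card) (hz : z + A.card + B.card ≤ r)
    (hyz : r < y + z + A.card + 3 * t) : c < A.card + B.card + y + 3 * z := by
  classical
  by_contra! hc
  obtain ⟨Y, hYB, rfl⟩ := Finset.exists_subset_card_eq hy
  have hdisj : Disjoint A B := by
    rw [Finset.disjoint_left]
    intro j hjA hjB
    exact ((hB j).1 hjB).2 hjA
  obtain ⟨Z, hZ, rfl⟩ : ∃ Z ⊆ (A ∪ B)ᶜ, Z.card = z := by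
    apply Finset.exists_subset_card_eq
    rw [Finset.card_compl, Fintype.card_fin, Finset.card_union_of_disjoint hdisj]
    omega
  obtain ⟨g, hg, hW⟩ := hF
    (fun j => if j ∈ A then {e j} else if j ∈ Y ∨ j ∈ Z then {e j, f j, h j}
      else if j ∈ B then (if f j = h j then {f j} else {e j}) else ∅) (by
      refine le_trans ?_ hc
      rw [card_eq_sum_ite A, card_eq_sum_ite B, card_eq_sum_ite Y, card_eq_sum_ite Z,
        Finset.mul_sum]
      simp only [← Finset.sum_add_distrib]
      refine Finset.sum_le_sum fun j _ => ?_
      have h3 := Finset.card_le_three (a := e j) (b := f j) (c := h j)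
      have hY := @hYB j
      have hBj := hB j
      have hAj := hA j
      by_cases a : j ∈ A
      · simp [a]; omega
      by_cases z : j ∈ Z
      · simp [a, z]; omega
      by_cases y : j ∈ Y
      · have b := hY y
        have h2 : ({e j, f j, h j} : Finset V).card ≤ 2 := by
          rcases (hBj.1 b).1 with q | q | q <;> simp only [q] <;>
            simp [Finset.card_le_two, Finset.pair_comm]
        simp [a, z, y, b]; omega
      by_cases b : j ∈ B
      · simp only [a, y, z, b]
        by_cases q : f j = h j <;> simp [q]
      · simp [a, y, z, b])
  have h1 := hI g hg e he
  have h2 := hI g hg f hf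
  have h3 := hI g hg h hh
  have key : (agreeSet g e).card + (agreeSet g f).card + (agreeSet g h).card
      + A.card + Y.card + Z.card ≤ ∑ _j : Fin r, 1 := by
    rw [card_eq_sum_ite Y, card_eq_sum_ite Z, card_eq_sum_ite (agreeSet g e),
      card_eq_sum_ite (agreeSet g f), card_eq_sum_ite (agreeSet g h), card_eq_sum_ite A]
    simp only [← Finset.sum_add_distrib]
    refine Finset.sum_le_sum fun j _ => ?_
    have hj := hW j
    have hY := @hYB j
    have hZj := @hZ j
    have hBj := hB j
    have hAj := hA j
    simp only [Finset.mem_compl, Finset.mem_union, mem_agreeSet] at hZj ⊢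
    by_cases a : j ∈ A
    · have e1 := hAj.1 a
      have y : j ∉ Y := fun y => (hBj.1 (hY y)).2 a
      have z : j ∉ Z := fun z => hZj z (Or.inl a)
      simp [a] at hj
      simp [a, y, z, e1.1, e1.2, hj]
    by_cases yz : j ∈ Y ∨ j ∈ Z
    · simp [a, yz] at hj
      have : ¬ (j ∈ Y ∧ j ∈ Z) := fun q => hZj q.2 (Or.inr (hY q.1))
      simp only [a, hj.1, hj.2.1, hj.2.2, if_false]
      clear hj hBj hAj hZj hY hW yz
      split_ifs <;> simp_all
    · push Not at yz
      by_cases b : j ∈ B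
      · simp only [a, b, yz.1, yz.2, if_false, or_self, if_true] at hj ⊢
        have e1 := (hBj.1 b).1
        by_cases q : f j = h j
        · simp only [q, if_true, Finset.mem_singleton] at hj ⊢
          simp only [hj, if_false]
          split_ifs <;> simp
        · simp only [q, if_false, Finset.mem_singleton] at hj ⊢
          rcases e1 with w | w | w
          · simp only [w, hj, if_false]
            split_ifs <;> simp
          · simp only [w, hj, if_false]
            split_ifs <;> simp
          · exact absurd w q
      · have e1 : f j ≠ e j ∧ h j ≠ e j ∧ f j ≠ h j := by
          refine ⟨fun w => ?_, fun w => ?_, fun w => ?_⟩ <;> exact b (hBj.2 ⟨by tauto, a⟩)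
        obtain ⟨w1, w2, w3⟩ := e1
        simp only [a, yz.1, yz.2, if_false]
        split_ifs with u1 u2 u3 u3 u2 u3
        · exact absurd (u2.symm.trans u1) w1
        · exact absurd (u2.symm.trans u1) w1
        · exact absurd (u3.symm.trans u1) w2
        · simp
        · exact absurd (u2.symm.trans u3) w3
        all_goals simp
  simp only [Finset.sum_const, Finset.card_univ, Fintype.card_fin, smul_eq_mul, mul_one] at key
  omega

theorem card_agreeSet_add {V : Type} {r : ℕ} {e f h : Fin r → V} {A B : Finset (Fin r)}
    (hA : ∀ j, j ∈ A ↔ f j = e j ∧ h j = e j)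
    (hB : ∀ j, j ∈ B ↔ (f j = e j ∨ h j = e j ∨ f j = h j) ∧ j ∉ A) :
    (agreeSet f e).card + (agreeSet h e).card + (agreeSet f h).card = B.card + 3 * A.card := by
  classical
  rw [card_eq_sum_ite (agreeSet f e), card_eq_sum_ite (agreeSet h e),
    card_eq_sum_ite (agreeSet f h), card_eq_sum_ite A, card_eq_sum_ite B, Finset.mul_sum]
  simp only [← Finset.sum_add_distrib]
  refine Finset.sum_congr rfl fun j _ => ?_
  simp only [hB, hA, mem_agreeSet]
  clear hA hB
  by_cases u : f j = e j <;> by_cases v : h j = e j <;> by_cases w : f j = h j <;> simp_all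

/-- Not all covers built from three transversals with `k₁`, `k₂`, `k₃` pairwise agreements and
`α` common ones can be large. -/
theorem no_small_candidate {t u x i d k₁ k₂ k₃ α β : ℤ}
    (hd : t = u + 2 * x - d) (hd0 : 0 ≤ d) (hd1 : d ≤ 1) (hi0 : 0 ≤ i) (hi3 : i ≤ 3)
    (hlo : t + 1 ≤ 4 * u + i) (hup : 4 * u + i + 1 ≤ 3 * t)
    (hk1t : t ≤ k₁) (hk1x : k₁ ≤ t + x - 1) (hk2 : k₁ ≤ k₂) (hk2x : k₂ ≤ t + x - 1)
    (hk3 : k₁ ≤ k₃) (hαp : α ≤ k₁ - x + d) (hα : k₂ + k₁ + d + 1 ≤ α + t + 2 * x)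
    (hcount : k₁ + k₂ + k₃ = β + 3 * α)
    (hαβ : α + β ≤ 4 * u + i + 2 * t - 1)
    (hpair : k₃ ≤ 4 * u + i → 5 * u + i + x < 2 * (4 * u + i) - k₃)
    (hpair' : 4 * u + i ≤ k₃ → 2 * (5 * u + i + x) < 4 * u + i + k₃)
    (h1 : 4 * u + i ≤ t + α → 5 * u + i + x < α + β)
    (h2 : t + α ≤ 4 * u + i → 4 * u + i ≤ t + α + β → 5 * u + i + x < 4 * u + i - t + β)
    (h3 : t + α + β ≤ 4 * u + i → 5 * u + i + x < 3 * (4 * u + i) - 3 * t - 2 * α - β) :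
    False := by
  obtain rfl : β = k₁ + k₂ + k₃ - 3 * α := by linarith
  rcases le_total k₃ (4 * u + i) with hk | hk
  · have := hpair hk
    clear hpair hpair'
    rcases le_total (4 * u + i) (t + α) with hN | hN
    · have := h1 hN
      clear h1 h2 h3
      subst hd
      obtain rfl | rfl : d = 0 ∨ d = 1 := by omega
      all_goals linarith
    · rcases le_total (4 * u + i) (t + α + (k₁ + k₂ + k₃ - 3 * α)) with hN' | hN'
      · have := h2 hN hN'
        clear h1 h2 h3
        subst hd
        obtain rfl | rfl : d = 0 ∨ d = 1 := by omega
        all_goals linarith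
      · have := h3 hN'
        clear h1 h2 h3
        subst hd
        obtain rfl | rfl : d = 0 ∨ d = 1 := by omega
        all_goals linarith
  · have := hpair' hk
    clear h1 h2 h3
    subst hd
    obtain rfl | rfl : d = 0 ∨ d = 1 := by omega
    all_goals linarith

/-- A nonempty family of pairwise `t`-agreeing transversals has a small cover. -/
theorem not_evades {V : Type} {r t : ℕ} (ht : 1 ≤ t) (hr : 3 * t ≤ r) (hr' : r + 2 ≤ 5 * t)
    {F : Set (Fin r → V)} (hne : F.Nonempty)
    (hI : ∀ e ∈ F, ∀ f ∈ F, t ≤ (agreeSet e f).card) :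
    ¬ Evades F (5 * (r - 2 * t + 1) / 4 + (6 * t + 6 - r) / 8) := by
  classical
  intro hF
  have hR : r + 1 = 2 * t + (r - 2 * t + 1) := by omega
  have hxdef : (6 * t + 6 - r) / 8 = (4 * t + 7 - (r - 2 * t + 1)) / 8 := by omega
  rw [hxdef] at hF
  generalize r - 2 * t + 1 = R at hF hR
  obtain ⟨u, i, rfl, hi⟩ : ∃ u i, R = 4 * u + i ∧ i ≤ 3 :=
    ⟨R / 4, R % 4, by omega, by omega⟩
  have hq : 5 * (4 * u + i) / 4 = 5 * u + i := by omega
  obtain ⟨x, hx⟩ : ∃ x, x = (4 * t + 7 - (4 * u + i)) / 8 := ⟨_, rfl⟩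
  rw [hq, ← hx] at hF
  have hx1 : t ≤ u + 2 * x := by omega
  have hx2 : u + 2 * x ≤ t + 1 := by omega
  have hx0 : 1 ≤ x := by omega
  have hxt : x ≤ t := by omega
  have hlo : t + 1 ≤ 4 * u + i := by omega
  have hup : 4 * u + i + 1 ≤ 3 * t := by omega
  have hmr : r + 1 ≤ 5 * u + i + x + t + x := by omega
  clear hx hq hxdef
  -- `e` and `f` agree on as few parts as possible.
  obtain ⟨⟨e, f⟩, ⟨he, hf⟩, hmin⟩ : ∃ p ∈ F ×ˢ F, ∀ p' ∈ F ×ˢ F,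
      (agreeSet p.2 p.1).card ≤ (agreeSet p'.2 p'.1).card := by
    have hne2 : (F ×ˢ F).Nonempty := hne.prod hne
    obtain ⟨p, hp, h⟩ := exists_minimalFor_of_wellFoundedLT (· ∈ F ×ˢ F)
      (fun p : (Fin r → V) × (Fin r → V) => (agreeSet p.2 p.1).card) hne2
    exact ⟨p, hp, fun p' hp' => (le_total _ _).elim id (h hp')⟩
  replace hmin : ∀ a ∈ F, ∀ b ∈ F, (agreeSet f e).card ≤ (agreeSet b a).card :=
    fun a ha b hb => hmin (a, b) ⟨ha, hb⟩
  have hk1t := hI f hf e he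
  have hk1x : (agreeSet f e).card ≤ t + x - 1 := by
    obtain ⟨M, -, hM⟩ := Finset.exists_subset_card_eq (s := (Finset.univ : Finset (Fin r)))
      (n := t + x - 1) (by rw [Finset.card_univ, Fintype.card_fin]; omega)
    obtain ⟨g, hg, hgM⟩ := hF.exists_agreeSet_subset e M (by omega)
    exact (hmin e he g hg).trans ((Finset.card_le_card hgM).trans hM.le)
  obtain ⟨p, hp⟩ : ∃ p, p + t = (agreeSet f e).card + u + x :=
    ⟨(agreeSet f e).card + u + x - t, by omega⟩
  have hpk : p ≤ (agreeSet f e).card := by omega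
  obtain ⟨P, hPK, hPp⟩ := Finset.exists_subset_card_eq hpk
  obtain ⟨N, hNK, hNn⟩ : ∃ N ⊆ (agreeSet f e)ᶜ, N.card = t + x - 1 - p := by
    apply Finset.exists_subset_card_eq
    rw [Finset.card_compl, Fintype.card_fin]
    omega
  have hM : (P ∪ N).card = t + x - 1 := by
    rw [Finset.card_union_of_disjoint
      (Finset.disjoint_of_subset_left hPK (Finset.subset_compl_iff_disjoint_left.1 hNK)),
      hPp, hNn]
    omega
  obtain ⟨h, hh, hhM⟩ := hF.exists_agreeSet_subset e (P ∪ N) (by omega)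
  have hk2 := hmin e he h hh
  have hk2x := Finset.card_le_card hhM
  have hk3 := hmin h hh f hf
  set A := agreeSet f e ∩ agreeSet h e with hAdef
  set B := (agreeSet f e ∪ agreeSet h e ∪ agreeSet f h) \ A with hBdef
  have hA : ∀ j, j ∈ A ↔ f j = e j ∧ h j = e j := fun j => by
    simp only [hAdef, Finset.mem_inter, mem_agreeSet]
  have hB : ∀ j, j ∈ B ↔ (f j = e j ∨ h j = e j ∨ f j = h j) ∧ j ∉ A := fun j => by
    simp only [hBdef, Finset.mem_sdiff, Finset.mem_union, mem_agreeSet, or_assoc]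
  have hAp : A.card ≤ p := by
    rw [← hPp]
    refine Finset.card_le_card fun j hj => ?_
    rw [hAdef, Finset.mem_inter] at hj
    refine (Finset.mem_union.1 (hhM hj.2)).resolve_right fun hjN => ?_
    exact Finset.mem_compl.1 (hNK hjN) hj.1
  have hAge : (agreeSet h e).card ≤ A.card + N.card := by
    refine le_trans (Finset.card_le_card fun j hj => ?_) (Finset.card_union_le A N)
    rcases Finset.mem_union.1 (hhM hj) with w | w
    · exact Finset.mem_union_left _ (Finset.mem_inter.2 ⟨hPK w, hj⟩)
    · exact Finset.mem_union_right _ w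
  have hcount : (agreeSet f e).card + (agreeSet h e).card + (agreeSet f h).card
      = B.card + 3 * A.card := card_agreeSet_add hA hB
  have hABr : A.card + B.card ≤ r := by
    rw [← Finset.card_union_of_disjoint (hBdef ▸ Finset.disjoint_sdiff)]
    exact (Finset.card_le_univ _).trans (Fintype.card_fin r).le
  have hpair := fun y z => hF.lt_of_pair hI hf hh (y := y) (z := z)
  have htriple := fun y z => hF.lt_of_triple hI he hf hh hA hB (y := y) (z := z)
  have hk3r : (agreeSet f h).card ≤ r :=
    (Finset.card_le_univ _).trans (Fintype.card_fin r).le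
  generalize A.card = α at *
  generalize B.card = β at *
  generalize (agreeSet f e).card = k₁ at *
  generalize (agreeSet h e).card = k₂ at *
  generalize (agreeSet f h).card = k₃ at *
  rw [hM] at hk2x
  rw [hNn] at hAge
  clear hmin hI hF hhM hPK hNK hA hB hAdef hBdef
  refine no_small_candidate (t := t) (u := u) (x := x) (i := i) (d := u + 2 * x - t)
    (k₁ := k₁) (k₂ := k₂) (k₃ := k₃) (α := α) (β := β) (by ring) (by omega) (by omega)
    (by omega) (by omega) (by omega) (by omega) (by omega) (by omega) (by omega) (by omega)
    (by omega) (by omega) (by omega) (by omega) (by omega) (fun hk => ?_) (fun hk => ?_)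
    (fun hN => ?_) (fun hN hN' => ?_) (fun hN => ?_)
  · have := hpair k₃ (4 * u + i - k₃) le_rfl (by omega) (by omega)
    omega
  · have := hpair ((4 * u + i + k₃ + 1) / 2) 0 (by omega) (by omega) (by omega)
    omega
  · have := htriple 0 0 (by omega) (by omega) (by omega)
    omega
  · have := htriple (4 * u + i - t - α) 0 (by omega) (by omega) (by omega)
    omega
  · have := htriple β (4 * u + i - t - α - β) le_rfl (by omega) (by omega)
    omega

/-- The transversals of the parts whose sets of values are edges. -/
def edgeFunctions {V : Type} {r : ℕ} (part : V → Fin r) (E : Finset (Finset V)) :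
    Set (Fin r → V) :=
  {φ | ∃ e ∈ E, ∀ v, v ∈ e ↔ φ (part v) = v}

theorem IsRPartite.exists_function {V : Type} {r : ℕ} {part : V → Fin r}
    {E : Finset (Finset V)} (hP : IsRPartite r part E) {e : Finset V} (he : e ∈ E) :
    ∃ φ : Fin r → V, (∀ j, φ j ∈ e) ∧ ∀ v, v ∈ e ↔ φ (part v) = v := by
  choose φ hφ using fun j => Finset.card_eq_one.1 (hP e he j)
  have hmem : ∀ j v, (v ∈ e ∧ part v = j) ↔ v = φ j := fun j v => by
    rw [← Finset.mem_singleton (a := φ j), ← hφ j, Finset.mem_filter]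
  refine ⟨φ, fun j => ((hmem j _).2 rfl).1, fun v => ⟨fun hv => ?_, fun hv => ?_⟩⟩
  · exact ((hmem _ v).1 ⟨hv, rfl⟩).symm
  · exact ((hmem _ v).2 hv.symm).1

theorem IntersectingGe.le_card_agreeSet {V : Type} {r t : ℕ} {part : V → Fin r}
    {E : Finset (Finset V)} (hI : IntersectingGe t E) {φ ψ : Fin r → V}
    (hφ : φ ∈ edgeFunctions part E) (hψ : ψ ∈ edgeFunctions part E) :
    t ≤ (agreeSet φ ψ).card := by
  obtain ⟨e, he, hφ⟩ := hφ
  obtain ⟨f, hf, hψ⟩ := hψ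
  refine (hI e he f hf).trans ?_
  rw [← Set.ncard_coe_finset]
  refine Set.ncard_le_ncard_of_injOn part (fun v hv => ?_) (fun v hv w hw hvw => ?_)
    (Finset.finite_toSet _)
  · exact mem_agreeSet.2 (((hφ v).1 hv.1).trans ((hψ v).1 hv.2).symm)
  · rw [← (hφ v).1 hv.1, ← (hφ w).1 hw.1, hvw]

theorem evades_of_lt_coverNumber {V : Type} {r c : ℕ} {part : V → Fin r}
    {E : Finset (Finset V)} (hP : IsRPartite r part E) (hc : c < coverNumber E) :
    Evades (edgeFunctions part E) c := by
  classical
  intro W hW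
  by_contra! hno
  refine absurd (coverNumber_le_card (C := Finset.univ.biUnion W) fun e he => ?_)
    (not_le.2 ((Finset.card_biUnion_le.trans hW).trans_lt hc))
  obtain ⟨φ, hφe, hφ⟩ := hP.exists_function he
  obtain ⟨j, hj⟩ := hno φ ⟨e, he, hφ⟩
  exact ⟨φ j, hφe j, Finset.mem_biUnion.2 ⟨j, Finset.mem_univ j, hj⟩⟩


/-- **First case of Proposition 2.7**: for `t ≥ 1` and `3t ≤ r ≤ 5t - 2`, every
`(r,t)`-graph `H` satisfies `τ(H) ≤ ⌈(5r - 10t + 2)/4⌉ + ⌈(6t - r - 1)/8⌉`. -/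
theorem cover_le_ceil_bound_first {V : Type} [Fintype V] (r t : ℕ)
    (ht : 1 ≤ t) (hr : 3 * t ≤ r) (hr' : (r : ℤ) ≤ 5 * (t : ℤ) - 2)
    (part : V → Fin r) (E : Finset (Finset V))
    (hP : IsRPartite r part E) (hI : IntersectingGe t E) :
    (coverNumber E : ℤ) ≤ ⌈(5 * (r : ℚ) - 10 * (t : ℚ) + 2) / 4⌉
      + ⌈(6 * (t : ℚ) - (r : ℚ) - 1) / 8⌉ := by
  have hle : coverNumber E ≤ 5 * (r - 2 * t + 1) / 4 + (6 * t + 6 - r) / 8 := by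
    by_contra! hlt
    have hev := evades_of_lt_coverNumber hP hlt
    obtain ⟨φ, hφ, -⟩ := hev (fun _ => ∅) (by simp)
    exact not_evades ht hr (by omega) ⟨φ, hφ⟩
      (fun _ hφ _ hψ => hI.le_card_agreeSet hφ hψ) hev
  have h1 : ((5 * (r - 2 * t + 1) / 4 : ℕ) : ℤ) ≤ ⌈(5 * (r : ℚ) - 10 * (t : ℚ) + 2) / 4⌉ := by
    rw [← Int.sub_one_lt_iff, Int.lt_ceil, lt_div_iff₀ (by norm_num)]
    have : (((5 * (r - 2 * t + 1) / 4 : ℕ) : ℤ) - 1) * 4 < 5 * (r : ℤ) - 10 * t + 2 := by omega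
    exact_mod_cast this
  have h2 : (((6 * t + 6 - r) / 8 : ℕ) : ℤ) ≤ ⌈(6 * (t : ℚ) - (r : ℚ) - 1) / 8⌉ := by
    rw [← Int.sub_one_lt_iff, Int.lt_ceil, lt_div_iff₀ (by norm_num)]
    have : ((((6 * t + 6 - r) / 8 : ℕ) : ℤ) - 1) * 8 < 6 * (t : ℤ) - r - 1 := by omega
    exact_mod_cast this
  omega
end
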